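/- Let G be a LERF word hyperbolic group and let A and B be quasiconvex subgroups of G. Then the product AB = {ab : a ∈ A, b ∈ B} is separable in G. -/

import Mathlib

open scoped Pointwise

/-- `S` is a finite symmetrized generating set of the group `G`. -/
def IsSymmGenSet {G : Type*} [Group G] (S : Set G) : Prop :=
  S.Finite ∧ S⁻¹ = S ∧ Subgroup.closure S = ⊤

/-- The word length of `g` with respect to the generating set `S`: the length of a
shortest word over `S` representing `g`. -/
noncomputable def wordLength {G : Type*} [Group G] (S : Set G) (g : G) : ℕ :=
  sInf {n : ℕ | ∃ f : Fin n → G, (∀ i, f i ∈ S) ∧ (List.ofFn f).prod = g}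

/-- The left-invariant word metric `d(x,y) = |x⁻¹y|_G` on `G`. -/
noncomputable def wordDist {G : Type*} [Group G] (S : Set G) (x y : G) : ℕ :=
  wordLength S (x⁻¹ * y)

/-- The Gromov product `(x|y)_w = (d(x,w)+d(y,w)-d(x,y))/2`. -/
noncomputable def gromovProd {G : Type*} [Group G] (S : Set G) (x y w : G) : ℝ :=
  ((wordDist S w x : ℝ) + (wordDist S w y : ℝ) - (wordDist S x y : ℝ)) / 2

/-- A discrete geodesic from `u` to `v` in the Cayley graph `Γ(G,S)`: a sequence of
vertices `p 0 = u, ..., p (d(u,v)) = v` with `d(p i, p j) = j - i`. -/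
def IsGeodesic {G : Type*} [Group G] (S : Set G) (u v : G) (p : ℕ → G) : Prop :=
  p 0 = u ∧ p (wordDist S u v) = v ∧
    ∀ i j : ℕ, i ≤ j → j ≤ wordDist S u v → wordDist S (p i) (p j) = j - i

/-- A subset `Q ⊆ G` is `ε`-quasiconvex if every geodesic between two elements of `Q`
lies in the closed `ε`-neighborhood of `Q`. -/
def IsQuasiconvex {G : Type*} [Group G] (S : Set G) (ε : ℝ) (Q : Set G) : Prop :=
  ∀ u ∈ Q, ∀ v ∈ Q, ∀ p : ℕ → G, IsGeodesic S u v p →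
    ∀ i ≤ wordDist S u v, ∃ q ∈ Q, (wordDist S (p i) q : ℝ) ≤ ε

/-- All geodesic triangles in `Γ(G,S)` are `δ`-thin: two points on the sides of a
geodesic triangle, equidistant from a common vertex (within the Gromov product),
are at distance at most `δ` from each other. -/
def ThinTriangles {G : Type*} [Group G] (S : Set G) (δ : ℝ) : Prop :=
  ∀ a b c : G, ∀ p q : ℕ → G, IsGeodesic S a b p → IsGeodesic S a c q →
    ∀ i : ℕ, (i : ℝ) ≤ gromovProd S b c a → (wordDist S (p i) (q i) : ℝ) ≤ δ

/-- The profinite topology on `G`: cosets of finite index normal subgroups form a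
basis of open sets (equivalently, a basis of neighborhoods of the identity). -/
def profiniteTopology (G : Type*) [Group G] : TopologicalSpace G :=
  TopologicalSpace.generateFrom
    {U : Set G | ∃ (g : G) (N : Subgroup G), N.Normal ∧ N.FiniteIndex ∧ U = g • (N : Set G)}

/-- A subset of `G` is separable if it is closed in the profinite topology on `G`. -/
def SeparableSubset (G : Type*) [Group G] (P : Set G) : Prop :=
  @IsClosed G (profiniteTopology G) P

/-- A word hyperbolic group `G` (with finite symmetrized generating set `S`) is GFERF
if every quasiconvex subgroup of `G` is separable. -/
def GFERF {G : Type*} [Group G] (S : Set G) : Prop :=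
  ∀ H : Subgroup G, (∃ ε : ℝ, 0 ≤ ε ∧ IsQuasiconvex S ε (H : Set G)) →
    SeparableSubset G (H : Set G)

/-- A `(λ,c)`-quasigeodesic path of length `n` in the Cayley graph `Γ(G,S)`:
consecutive vertices are adjacent and every subpath `p|_{[i,j]}` satisfies
`λ(j-i) - c ≤ d(p i, p j)`. -/
def IsQuasigeodesicOn {G : Type*} [Group G] (S : Set G) (lam c : ℝ) (p : ℕ → G) (n : ℕ) : Prop :=
  (∀ i < n, wordDist S (p i) (p (i + 1)) = 1) ∧
    ∀ i j : ℕ, i ≤ j → j ≤ n → lam * ((j : ℝ) - (i : ℝ)) - c ≤ (wordDist S (p i) (p j) : ℝ)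

section WordLength

variable {G : Type*} [Group G] {S : Set G}

theorem wordLength_prod_le (l : List G) (hl : ∀ x ∈ l, x ∈ S) :
    wordLength S l.prod ≤ l.length :=
  Nat.sInf_le ⟨l.get, fun i => hl _ (l.get_mem i), by rw [List.ofFn_get]⟩

theorem IsSymmGenSet.exists_list (hS : IsSymmGenSet S) (g : G) :
    ∃ l : List G, (∀ x ∈ l, x ∈ S) ∧ l.prod = g ∧ l.length = wordLength S g := by
  have hne : {n : ℕ | ∃ f : Fin n → G, (∀ i, f i ∈ S) ∧ (List.ofFn f).prod = g}.Nonempty := by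
    have hg : g ∈ Submonoid.closure S := by
      have h : g ∈ (Subgroup.closure S).toSubmonoid := by
        rw [hS.2.2]
        trivial
      rwa [Subgroup.closure_toSubmonoid, hS.2.1, Set.union_self] at h
    obtain ⟨l, hl, rfl⟩ := Submonoid.exists_list_of_mem_closure hg
    exact ⟨l.length, l.get, fun i => hl _ (l.get_mem i), by rw [List.ofFn_get]⟩
  obtain ⟨f, hf, hprod⟩ := Nat.sInf_mem hne
  refine ⟨List.ofFn f, fun x hx => ?_, hprod, by rw [List.length_ofFn]; rfl⟩
  obtain ⟨i, rfl⟩ := (List.mem_ofFn' _ _).1 hx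
  exact hf i

theorem wordLength_one : wordLength S (1 : G) = 0 := by
  simpa using wordLength_prod_le (S := S) [] (by simp)

theorem IsSymmGenSet.wordLength_mul_le (hS : IsSymmGenSet S) (g h : G) :
    wordLength S (g * h) ≤ wordLength S g + wordLength S h := by
  obtain ⟨l, hl, rfl, hlen⟩ := hS.exists_list g
  obtain ⟨m, hm, rfl, hmen⟩ := hS.exists_list h
  rw [← hlen, ← hmen, ← List.prod_append, ← List.length_append]
  refine wordLength_prod_le _ fun x hx => ?_
  rcases List.mem_append.1 hx with h | h
  exacts [hl x h, hm x h]

theorem IsSymmGenSet.wordLength_inv_le (hS : IsSymmGenSet S) (g : G) :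
    wordLength S g⁻¹ ≤ wordLength S g := by
  obtain ⟨l, hl, rfl, hlen⟩ := hS.exists_list g
  rw [← hlen, List.prod_inv_reverse]
  refine (wordLength_prod_le _ fun x hx => ?_).trans_eq (by simp)
  simp only [List.mem_reverse, List.mem_map] at hx
  obtain ⟨y, hy, rfl⟩ := hx
  rw [← hS.2.1]
  simpa using hl y hy

theorem IsSymmGenSet.wordLength_inv (hS : IsSymmGenSet S) (g : G) :
    wordLength S g⁻¹ = wordLength S g :=
  le_antisymm (hS.wordLength_inv_le g) (by simpa using hS.wordLength_inv_le g⁻¹)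

/-- The triangle inequality, read along the factorization `g * h = (g * k) * (k⁻¹ * h)`. -/
theorem IsSymmGenSet.wordLength_mul_le_via (hS : IsSymmGenSet S) (g h k : G) :
    wordLength S (g * h) ≤ wordLength S (g * k) + wordLength S (k⁻¹ * h) := by
  simpa [mul_assoc] using hS.wordLength_mul_le (g * k) (k⁻¹ * h)

theorem IsSymmGenSet.finite_ball (hS : IsSymmGenSet S) (n : ℕ) :
    {g : G | wordLength S g ≤ n}.Finite := by
  have : Finite S := hS.1
  refine ((List.finite_length_le S n).image fun l => (l.map Subtype.val).prod).subset ?_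
  intro g hg
  obtain ⟨l, hl, rfl, hlen⟩ := hS.exists_list g
  lift l to List S using hl
  exact ⟨l, by simpa using hlen.trans_le hg, rfl⟩

theorem IsSymmGenSet.exists_isGeodesic (hS : IsSymmGenSet S) (u v : G) :
    ∃ p, IsGeodesic S u v p := by
  obtain ⟨l, hl, hprod, hlen⟩ := hS.exists_list (u⁻¹ * v)
  have hupper : ∀ i j, i ≤ j →
      wordLength S ((l.take i).prod⁻¹ * (l.take j).prod) ≤ j - i := by
    intro i j hij
    obtain ⟨k, rfl⟩ := Nat.exists_eq_add_of_le hij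
    rw [List.take_add, List.prod_append, inv_mul_cancel_left]
    refine (wordLength_prod_le _ fun x hx => ?_).trans ?_
    · exact hl x (List.mem_of_mem_drop (List.mem_of_mem_take hx))
    · simp
  refine ⟨fun i => u * (l.take i).prod, by simp, ?_, fun i j hij hj => ?_⟩
  · simp only [wordDist, ← hlen, List.take_length, hprod, mul_inv_cancel_left]
  · have hdist : wordDist S (u * (l.take i).prod) (u * (l.take j).prod)
        = wordLength S ((l.take i).prod⁻¹ * (l.take j).prod) := by
      simp [wordDist, mul_assoc]
    rw [hdist]
    refine le_antisymm (hupper i j hij) ?_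
    rw [wordDist, ← hlen] at hj
    have h1 := hupper 0 i (Nat.zero_le _)
    have h2 := hupper j l.length hj
    have h3 := hS.wordLength_mul_le_via 1 (l.take l.length).prod (l.take j).prod
    have h4 := hS.wordLength_mul_le_via 1 (l.take j).prod (l.take i).prod
    simp only [List.take_zero, List.prod_nil, inv_one, one_mul, List.take_length] at h1 h2 h3 h4
    rw [hprod, ← hlen] at h3
    rw [hprod] at h2
    omega

end WordLength

section Hyperbolic

variable {G : Type*} [Group G] {S : Set G} {δ : ℝ}

/-- The four-point inequality for Gromov products based at the identity. -/
theorem ThinTriangles.min_gromovProd_le (hS : IsSymmGenSet S) (hhyp : ThinTriangles S δ)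
    (x y z : G) :
    min (gromovProd S x y 1) (gromovProd S y z 1) ≤ gromovProd S x z 1 + δ + 1 := by
  obtain ⟨p, hp⟩ := hS.exists_isGeodesic 1 x
  obtain ⟨q, hq⟩ := hS.exists_isGeodesic 1 y
  obtain ⟨r, hr⟩ := hS.exists_isGeodesic 1 z
  have hxy_le : gromovProd S x y 1 ≤ wordLength S x := by
    have h := hS.wordLength_mul_le x (x⁻¹ * y)
    simp only [mul_inv_cancel_left] at h
    simp only [gromovProd, wordDist, inv_one, one_mul]
    have : (wordLength S y : ℝ) ≤ wordLength S x + wordLength S (x⁻¹ * y) := by exact_mod_cast h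
    linarith
  have hyz_le : gromovProd S y z 1 ≤ wordLength S z := by
    have h := hS.wordLength_mul_le z (y⁻¹ * z)⁻¹
    rw [hS.wordLength_inv] at h
    simp only [mul_inv_rev, inv_inv, mul_inv_cancel_left] at h
    simp only [gromovProd, wordDist, inv_one, one_mul]
    have : (wordLength S y : ℝ) ≤ wordLength S z + wordLength S (y⁻¹ * z) := by exact_mod_cast h
    linarith
  have hxy_nonneg : 0 ≤ gromovProd S x y 1 := by
    have h := hS.wordLength_mul_le x⁻¹ y
    rw [hS.wordLength_inv] at h
    simp only [gromovProd, wordDist, inv_one, one_mul]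
    have : (wordLength S (x⁻¹ * y) : ℝ) ≤ wordLength S x + wordLength S y := by exact_mod_cast h
    linarith
  have hyz_nonneg : 0 ≤ gromovProd S y z 1 := by
    have h := hS.wordLength_mul_le y⁻¹ z
    rw [hS.wordLength_inv] at h
    simp only [gromovProd, wordDist, inv_one, one_mul]
    have : (wordLength S (y⁻¹ * z) : ℝ) ≤ wordLength S y + wordLength S z := by exact_mod_cast h
    linarith
  set m := min (gromovProd S x y 1) (gromovProd S y z 1) with hm
  have hm0 : 0 ≤ m := le_min hxy_nonneg hyz_nonneg
  set t := ⌊m⌋₊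
  have htm : (t : ℝ) ≤ m := Nat.floor_le hm0
  have hmt : m < t + 1 := Nat.lt_floor_add_one m
  have hpq := hhyp 1 x y p q hp hq t (htm.trans (min_le_left _ _))
  have hqr := hhyp 1 y z q r hq hr t (htm.trans (min_le_right _ _))
  have htx : t ≤ wordLength S x := by
    exact_mod_cast (htm.trans (min_le_left _ _)).trans hxy_le
  have htz : t ≤ wordLength S z := by
    exact_mod_cast (htm.trans (min_le_right _ _)).trans hyz_le
  obtain ⟨-, hpx, hp⟩ := hp
  obtain ⟨-, hrz, hr⟩ := hr
  simp only [wordDist, inv_one, one_mul] at hpx hp hrz hr hpq hqr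
  have hpt := hp t _ htx le_rfl
  have hrt := hr t _ htz le_rfl
  rw [hpx, ← hS.wordLength_inv, mul_inv_rev, inv_inv] at hpt
  rw [hrz] at hrt
  have h1 := hS.wordLength_mul_le_via x⁻¹ z (p t)
  have h2 := hS.wordLength_mul_le_via (p t)⁻¹ z (r t)
  have h3 := hS.wordLength_mul_le_via (p t)⁻¹ (r t) (q t)
  have h4 : (wordLength S (x⁻¹ * z) + 2 * t : ℝ) ≤ wordLength S x + wordLength S z
      + (wordLength S ((p t)⁻¹ * q t) + wordLength S ((q t)⁻¹ * r t)) := by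
    norm_cast
    omega
  simp only [gromovProd, wordDist, inv_one, one_mul]
  linarith

/-- Local-to-global step: if the corners of the broken line `1, u, u * x, u * x * z` are far from
being backtracks and the middle side is long, then so is the corner of `1, u * x, u * x * z`. -/
theorem ThinTriangles.add_le_wordLength_mul (hS : IsSymmGenSet S) (hhyp : ThinTriangles S δ)
    {K : ℝ} {u x z : G}
    (hux : (wordLength S u : ℝ) + wordLength S x - 2 * (K + δ + 1) ≤ wordLength S (u * x))
    (hxz : (wordLength S x : ℝ) + wordLength S z - 2 * K ≤ wordLength S (x * z))
    (hx : 2 * (K + δ + 1) < wordLength S x) :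
    (wordLength S (u * x) : ℝ) + wordLength S z - 2 * (K + δ + 1)
      ≤ wordLength S (u * x * z) := by
  have h := hhyp.min_gromovProd_le hS x⁻¹ (u * x)⁻¹ z
  simp only [gromovProd, wordDist, inv_one, one_mul, hS.wordLength_inv, inv_inv] at h
  rw [mul_inv_rev, mul_inv_cancel_left, hS.wordLength_inv] at h
  rcases min_le_iff.1 h with h | h <;> linarith

/-- If `x` is a shortest element of the coset `x (H₁ ∩ H₂)`, where `H₁`, `H₂` are quasiconvex and
`x ∈ H₁`, then there is only bounded cancellation in products `x * y` with `y ∈ H₂`. -/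
theorem exists_bounded_cancellation (hS : IsSymmGenSet S) (hhyp : ThinTriangles S δ)
    {H₁ H₂ : Subgroup G} {ε₁ ε₂ : ℝ} (hH₁ : IsQuasiconvex S ε₁ (H₁ : Set G))
    (hH₂ : IsQuasiconvex S ε₂ (H₂ : Set G)) :
    ∃ K : ℝ, ∀ x ∈ H₁, (∀ d ∈ H₁ ⊓ H₂, wordLength S x ≤ wordLength S (x * d)) →
      ∀ y ∈ H₂, (wordLength S x : ℝ) + wordLength S y - 2 * K ≤ wordLength S (x * y) := by
  obtain ⟨R, hR⟩ := exists_nat_ge (ε₁ + δ + ε₂)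
  obtain ⟨M, hM⟩ := exists_nat_gt (2 * ε₁)
  have hball := hS.finite_ball R
  set N := hball.toFinset.card
  refine ⟨(N * M : ℕ), fun x hx hmin y hy => ?_⟩
  by_contra hlt
  have hgp : ((N * M : ℕ) : ℝ) ≤ gromovProd S x⁻¹ y 1 := by
    simp only [gromovProd, wordDist, inv_one, one_mul, inv_inv, hS.wordLength_inv]
    linarith
  have hgpx : gromovProd S x⁻¹ y 1 ≤ wordLength S x := by
    have h := hS.wordLength_mul_le x⁻¹ (x * y)
    simp only [inv_mul_cancel_left, hS.wordLength_inv] at h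
    simp only [gromovProd, wordDist, inv_one, one_mul, inv_inv, hS.wordLength_inv]
    have : (wordLength S y : ℝ) ≤ wordLength S x + wordLength S (x * y) := by exact_mod_cast h
    linarith
  have hgpy : gromovProd S x⁻¹ y 1 ≤ wordLength S y := by
    have h := hS.wordLength_mul_le (x * y) y⁻¹
    simp only [mul_inv_cancel_right, hS.wordLength_inv] at h
    simp only [gromovProd, wordDist, inv_one, one_mul, inv_inv, hS.wordLength_inv]
    have : (wordLength S x : ℝ) ≤ wordLength S (x * y) + wordLength S y := by exact_mod_cast h
    linarith
  obtain ⟨p, hp⟩ := hS.exists_isGeodesic 1 x⁻¹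
  obtain ⟨q, hq⟩ := hS.exists_isGeodesic 1 y
  have hclose : ∀ k : ℕ, k ≤ N → ∃ u ∈ H₁, ∃ v ∈ H₂,
      (wordLength S ((p (k * M))⁻¹ * u) : ℝ) ≤ ε₁ ∧ wordLength S (u⁻¹ * v) ≤ R := by
    intro k hk
    have hkM : ((k * M : ℕ) : ℝ) ≤ gromovProd S x⁻¹ y 1 :=
      le_trans (by exact_mod_cast Nat.mul_le_mul_right M hk) hgp
    obtain ⟨u, hu, hpu⟩ := hH₁ 1 H₁.one_mem x⁻¹ (H₁.inv_mem hx) p hp (k * M) (by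
      simp only [wordDist, inv_one, one_mul, hS.wordLength_inv]
      exact_mod_cast hkM.trans hgpx)
    obtain ⟨v, hv, hqv⟩ := hH₂ 1 H₂.one_mem y hy q hq (k * M) (by
      simp only [wordDist, inv_one, one_mul]
      exact_mod_cast hkM.trans hgpy)
    have hpq := hhyp 1 x⁻¹ y p q hp hq _ hkM
    simp only [wordDist] at hpu hqv hpq
    refine ⟨u, hu, v, hv, hpu, ?_⟩
    have h1 := hS.wordLength_mul_le_via u⁻¹ v (p (k * M))
    have h2 := hS.wordLength_mul_le_via (p (k * M))⁻¹ v (q (k * M))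
    rw [← hS.wordLength_inv (u⁻¹ * p (k * M)), mul_inv_rev, inv_inv] at h1
    have h3 : (wordLength S (u⁻¹ * v) : ℝ) ≤ wordLength S ((p (k * M))⁻¹ * u)
        + (wordLength S ((p (k * M))⁻¹ * q (k * M)) + wordLength S ((q (k * M))⁻¹ * v)) := by
      norm_cast
      omega
    exact_mod_cast (show (wordLength S (u⁻¹ * v) : ℝ) ≤ R by linarith)
  choose! u hu v hv hpu huv using hclose
  obtain ⟨i, hi, j, hj, hij, heq⟩ : ∃ i ≤ N, ∃ j ≤ N, i < j ∧ (u i)⁻¹ * v i = (u j)⁻¹ * v j := by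
    obtain ⟨i, hi, j, hj, hne, heq⟩ := Finset.exists_ne_map_eq_of_card_lt_of_maps_to
      (s := Finset.range (N + 1)) (t := hball.toFinset) (f := fun k => (u k)⁻¹ * v k)
      (by simp [N]) (fun k hk => by
        simpa using huv k (Nat.lt_succ_iff.1 (by simpa using hk)))
    rw [Finset.mem_range, Nat.lt_succ_iff] at hi hj
    rcases hne.lt_or_gt with h | h
    exacts [⟨i, hi, j, hj, h, heq⟩, ⟨j, hj, i, hi, h, heq.symm⟩]
  have hd : u j * (u i)⁻¹ ∈ H₁ ⊓ H₂ := by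
    refine ⟨H₁.mul_mem (hu j hj) (H₁.inv_mem (hu i hi)), ?_⟩
    have : u j * (u i)⁻¹ = v j * (v i)⁻¹ := by
      have hvi : v i = u i * ((u j)⁻¹ * v j) := by rw [← heq]; group
      rw [hvi]
      group
    rw [this]
    exact H₂.mul_mem (hv j hj) (H₂.inv_mem (hv i hi))
  have hxd := hmin _ hd
  obtain ⟨hp0, hpx, hp⟩ := hp
  simp only [wordDist, inv_one, one_mul, hS.wordLength_inv] at hpx hp
  have hjx : j * M ≤ wordLength S x := by
    have : ((j * M : ℕ) : ℝ) ≤ wordLength S x :=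
      le_trans (by exact_mod_cast Nat.mul_le_mul_right M hj) (hgp.trans hgpx)
    exact_mod_cast this
  have hijM : i * M + M ≤ j * M := by nlinarith
  have hpi := hp 0 (i * M) (Nat.zero_le _) (by omega)
  have hpj := hp (j * M) _ hjx le_rfl
  rw [hp0, inv_one, one_mul] at hpi
  rw [hpx, ← mul_inv_rev, hS.wordLength_inv] at hpj
  have h1 := hS.wordLength_mul_le (x * u j) (u i)⁻¹
  have h2 := hS.wordLength_mul_le_via x (u j) (p (j * M))
  have h3 := hS.wordLength_mul_le_via 1 (u i) (p (i * M))
  rw [hS.wordLength_inv, mul_assoc] at h1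
  simp only [one_mul] at h3
  have h4 : (M : ℝ) ≤ wordLength S ((p (i * M))⁻¹ * u i)
      + wordLength S ((p (j * M))⁻¹ * u j) := by
    norm_cast
    omega
  linarith [hpu i hi, hpu j hj]

/-- A quasiconvex subgroup is finitely generated. -/
theorem IsQuasiconvex.fg (hS : IsSymmGenSet S) {H : Subgroup G} {ε : ℝ}
    (hH : IsQuasiconvex S ε (H : Set G)) : H.FG := by
  obtain ⟨R, hR⟩ := exists_nat_ge (ε + 1 + ε)
  have hfin : {g : G | g ∈ H ∧ wordLength S g ≤ R}.Finite :=
    (hS.finite_ball R).subset fun g hg => hg.2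
  refine (Subgroup.fg_iff H).2
    ⟨_, le_antisymm ((Subgroup.closure_le H).2 fun g hg => hg.1) ?_, hfin⟩
  intro h hh
  obtain ⟨p, hp⟩ := hS.exists_isGeodesic 1 h
  have hclose := hH 1 H.one_mem h hh p hp
  obtain ⟨hp0, hph, hp⟩ := hp
  simp only [wordDist, inv_one, one_mul] at hclose hph hp
  have hε : 0 ≤ ε := by
    obtain ⟨q, -, hq⟩ := hclose 0 (Nat.zero_le _)
    exact (Nat.cast_nonneg _).trans hq
  have hnear : ∀ i ≤ wordLength S h, ∀ q ∈ H, (wordLength S ((p i)⁻¹ * q) : ℝ) ≤ ε →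
      q ∈ Subgroup.closure {g : G | g ∈ H ∧ wordLength S g ≤ R} := by
    intro i
    induction i with
    | zero =>
      intro _ q hq hpq
      refine Subgroup.subset_closure ⟨hq, ?_⟩
      rw [hp0, inv_one, one_mul] at hpq
      exact_mod_cast (show (wordLength S q : ℝ) ≤ R by linarith)
    | succ i ih =>
      intro hi q hq hpq
      obtain ⟨q', hq', hpq'⟩ := hclose i (by omega)
      have hstep : q'⁻¹ * q ∈ Subgroup.closure {g : G | g ∈ H ∧ wordLength S g ≤ R} := by
        refine Subgroup.subset_closure ⟨H.mul_mem (H.inv_mem hq') hq, ?_⟩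
        have h1 := hS.wordLength_mul_le_via q'⁻¹ q (p i)
        have h2 := hS.wordLength_mul_le_via (p i)⁻¹ q (p (i + 1))
        rw [← hS.wordLength_inv (q'⁻¹ * p i), mul_inv_rev, inv_inv] at h1
        rw [hp i (i + 1) (by omega) hi] at h2
        have h3 : (wordLength S (q'⁻¹ * q) : ℝ) ≤ wordLength S ((p i)⁻¹ * q')
            + (1 + wordLength S ((p (i + 1))⁻¹ * q)) := by
          norm_cast
          omega
        exact_mod_cast (show (wordLength S (q'⁻¹ * q) : ℝ) ≤ R by linarith)
      simpa using Subgroup.mul_mem _ (ih (by omega) q' hq' hpq') hstep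
  refine hnear _ le_rfl h hh ?_
  rw [hph, inv_mul_cancel, wordLength_one]
  simpa using hε

end Hyperbolic

section ProfiniteTopology

variable {G : Type*} [Group G]

theorem exists_normal_smul_subset_of_isOpen {U : Set G}
    (hU : @IsOpen G (profiniteTopology G) U) {x : G} (hx : x ∈ U) :
    ∃ N : Subgroup G, N.Normal ∧ N.FiniteIndex ∧ ∀ n ∈ N, x * n ∈ U := by
  induction hU with
  | basic V hV =>
    obtain ⟨g, N, hN, hfin, rfl⟩ := hV
    refine ⟨N, hN, hfin, fun n hn => ?_⟩
    rw [mem_leftCoset_iff] at hx ⊢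
    rw [← mul_assoc]
    exact N.mul_mem hx hn
  | univ => exact ⟨⊤, inferInstance, inferInstance, fun _ _ => trivial⟩
  | inter V W _ _ hV hW =>
    obtain ⟨N, hN, hNfin, hNV⟩ := hV hx.1
    obtain ⟨N', hN', hNfin', hNW⟩ := hW hx.2
    exact ⟨N ⊓ N', inferInstance, inferInstance, fun n hn => ⟨hNV n hn.1, hNW n hn.2⟩⟩
  | sUnion 𝒱 _ ih =>
    obtain ⟨V, hV, hxV⟩ := hx
    obtain ⟨N, hN, hfin, hNV⟩ := ih V hV hxV
    exact ⟨N, hN, hfin, fun n hn => ⟨V, hV, hNV n hn⟩⟩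

theorem SeparableSubset.preimage_mul_mul {P : Set G} (hP : SeparableSubset G P) (a b : G) :
    SeparableSubset G {x | a * x * b ∈ P} := by
  let := profiniteTopology G
  have hcont : Continuous fun x : G => a * x * b := by
    refine continuous_generateFrom_iff.2 ?_
    rintro _ ⟨g, N, hN, hfin, rfl⟩
    refine TopologicalSpace.isOpen_generateFrom_of_mem ⟨a⁻¹ * g * b⁻¹, N, hN, hfin, ?_⟩
    ext x
    rw [Set.mem_preimage, mem_leftCoset_iff, mem_leftCoset_iff, SetLike.mem_coe, SetLike.mem_coe]
    have : (a⁻¹ * g * b⁻¹)⁻¹ * x = b * (g⁻¹ * (a * x * b)) * b⁻¹ := by group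
    rw [this]
    exact ⟨fun h => hN.conj_mem _ h b, fun h => by
      simpa [mul_assoc] using hN.conj_mem _ h b⁻¹⟩
  exact IsClosed.preimage hcont hP

/-- A separable subgroup `D` is contained in a finite index subgroup which contains no further
element of a given finite set. -/
theorem SeparableSubset.exists_finiteIndex {D : Subgroup G}
    (hD : SeparableSubset G (D : Set G)) {F : Set G} (hF : F.Finite) :
    ∃ M : Subgroup G, M.FiniteIndex ∧ D ≤ M ∧ ∀ x ∈ F, x ∈ M → x ∈ D := by
  induction F, hF using Set.Finite.induction_on with
  | empty => exact ⟨⊤, inferInstance, le_top, by simp⟩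
  | @insert x F _ _ ih =>
    obtain ⟨M, hM, hDM, hMF⟩ := ih
    by_cases hx : x ∈ D
    · refine ⟨M, hM, hDM, ?_⟩
      rintro y (rfl | hy) hyM
      exacts [hx, hMF y hy hyM]
    · obtain ⟨N, hN, hNfin, hNx⟩ := exists_normal_smul_subset_of_isOpen hD.isOpen_compl
        (show x ∈ (D : Set G)ᶜ from hx)
      have : (D ⊔ N).FiniteIndex := Subgroup.finiteIndex_of_le le_sup_right
      refine ⟨M ⊓ (D ⊔ N), inferInstance, le_inf hDM le_sup_left, ?_⟩
      rintro y (rfl | hy) hyM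
      · obtain ⟨d, hd, n, hn, rfl⟩ := Subgroup.mem_sup_of_normal_right.1 hyM.2
        exact absurd hd (by simpa using hNx n⁻¹ (N.inv_mem hn))
      · exact hMF y hy hyM.1

theorem Subgroup.FG.inf_of_finiteIndex {A : Subgroup G} (hA : A.FG) (M : Subgroup G)
    [M.FiniteIndex] : (A ⊓ M).FG := by
  have : Group.FG A := (Group.fg_iff_subgroup_fg A).2 hA
  have h : (M.subgroupOf A).FG := (Group.fg_iff_subgroup_fg _).1 (Subgroup.fg_of_index_ne_zero _)
  obtain ⟨T, hT⟩ := h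
  have hmap := congrArg (Subgroup.map A.subtype) hT
  rw [MonoidHom.map_closure, Subgroup.subgroupOf_map_subtype, inf_comm] at hmap
  exact (Subgroup.fg_iff _).2 ⟨_, hmap, T.finite_toSet.image _⟩

theorem Subgroup.exists_finite_leftTransversal_inf (A M : Subgroup G) [M.FiniteIndex] :
    ∃ T : Set G, T.Finite ∧ T ⊆ A ∧ ∀ a ∈ A, ∃ t ∈ T, t⁻¹ * a ∈ A ⊓ M := by
  have : Finite (A ⧸ M.subgroupOf A) := Subgroup.finite_quotient_of_finiteIndex
  refine ⟨Set.range fun c : A ⧸ M.subgroupOf A => (c.out : G), Set.finite_range _, ?_,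
    fun a ha => ⟨_, ⟨QuotientGroup.mk ⟨a, ha⟩, rfl⟩, ?_⟩⟩
  · rintro _ ⟨c, rfl⟩
    exact c.out.2
  · have h : (QuotientGroup.mk (s := M.subgroupOf A) ⟨a, ha⟩).out⁻¹ * ⟨a, ha⟩ ∈ M.subgroupOf A :=
      QuotientGroup.eq.1 (QuotientGroup.out_eq' _)
    exact ⟨A.mul_mem (A.inv_mem (SetLike.coe_mem _)) ha, Subgroup.mem_subgroupOf.1 h⟩

/-- If `H` is a separable subgroup containing finite index subgroups of `A` and of `B`, then
`A H B` is separable. -/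
theorem SeparableSubset.mul_mul {A B M H : Subgroup G} [M.FiniteIndex]
    (hH : SeparableSubset G (H : Set G)) (hAH : A ⊓ M ≤ H) (hBH : B ⊓ M ≤ H) :
    SeparableSubset G ((A : Set G) * (H : Set G) * (B : Set G)) := by
  obtain ⟨T, hT, hTA, hAT⟩ := A.exists_finite_leftTransversal_inf M
  obtain ⟨T', hT', hTB, hBT⟩ := B.exists_finite_leftTransversal_inf M
  have heq : (A : Set G) * (H : Set G) * (B : Set G)
      = ⋃ t ∈ T, ⋃ s ∈ T', {x | t⁻¹ * x * s ∈ (H : Set G)} := by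
    ext x
    simp only [Set.mem_mul, Set.mem_iUnion, Set.mem_ofPred_eq, SetLike.mem_coe]
    constructor
    · rintro ⟨_, ⟨a, ha, h, hh, rfl⟩, b, hb, rfl⟩
      obtain ⟨t, ht, hta⟩ := hAT a ha
      obtain ⟨s, hs, hsb⟩ := hBT b⁻¹ (B.inv_mem hb)
      refine ⟨t, ht, s, hs, ?_⟩
      have : t⁻¹ * (a * h * b) * s = (t⁻¹ * a) * h * (s⁻¹ * b⁻¹)⁻¹ := by group
      rw [this]
      exact H.mul_mem (H.mul_mem (hAH hta) hh) (H.inv_mem (hBH hsb))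
    · rintro ⟨t, ht, s, hs, hx⟩
      exact ⟨t * (t⁻¹ * x * s), ⟨t, hTA ht, _, hx, rfl⟩, s⁻¹, B.inv_mem (hTB hs), by group⟩
  rw [heq]
  let := profiniteTopology G
  exact hT.isClosed_biUnion fun t _ => hT'.isClosed_biUnion fun s _ =>
    hH.preimage_mul_mul t⁻¹ s

end ProfiniteTopology

section AlternatingProducts

variable {G : Type*} [Group G]

/-- `IsAlternatingProduct H H' D b w` says that `w` is a product of an element of `H true` and of
elements taken alternately from `H' false \ D` and `H' true \ D`, where `b` tells which of the two
families the last factor belongs to. -/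
inductive IsAlternatingProduct (H H' : Bool → Subgroup G) (D : Subgroup G) : Bool → G → Prop
  | base (a : G) (ha : a ∈ H true) : IsAlternatingProduct H H' D true a
  | step (b : Bool) (u x : G) (hu : IsAlternatingProduct H H' D b u) (hx : x ∈ H' (!b))
      (hxD : x ∉ D) : IsAlternatingProduct H H' D (!b) (u * x)

variable {H H' : Bool → Subgroup G} {D : Subgroup G}

theorem IsAlternatingProduct.mul_mem_inf (hH : ∀ b, H' b ≤ H b) (hD : ∀ b, D ≤ H' b) {b : Bool}
    {w d : G} (hw : IsAlternatingProduct H H' D b w) (hd : d ∈ D) :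
    IsAlternatingProduct H H' D b (w * d) := by
  cases hw with
  | base a ha => exact .base _ ((H true).mul_mem ha (hH _ (hD _ hd)))
  | step b u x hu hx hxD =>
    rw [mul_assoc]
    exact .step b u _ hu ((H' _).mul_mem hx (hD _ hd)) fun h =>
      hxD ((D.mul_mem_cancel_right hd).1 h)

theorem IsAlternatingProduct.exists_mul (hH : ∀ b, H' b ≤ H b) (hD : ∀ b, D ≤ H' b) {b c : Bool}
    {w y : G} (hw : IsAlternatingProduct H H' D b w) (hy : y ∈ H' c) :
    ∃ b', IsAlternatingProduct H H' D b' (w * y) := by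
  by_cases hyD : y ∈ D
  · exact ⟨b, hw.mul_mem_inf hH hD hyD⟩
  rcases Bool.eq_or_eq_not c b with rfl | rfl
  · cases hw with
    | base a ha => exact ⟨true, .base _ ((H true).mul_mem ha (hH _ hy))⟩
    | step b u x hu hx hxD =>
      rw [mul_assoc]
      by_cases hxy : x * y ∈ D
      · exact ⟨b, hu.mul_mem_inf hH hD hxy⟩
      · exact ⟨!b, .step b u _ hu ((H' _).mul_mem hx hy) hxy⟩
  · exact ⟨!b, .step b w y hw hy hyD⟩

theorem IsAlternatingProduct.exists_mul_iSup (hH : ∀ b, H' b ≤ H b) (hD : ∀ b, D ≤ H' b) {a h : G}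
    (ha : a ∈ H true) (hh : h ∈ ⨆ b, H' b) :
    ∃ b, IsAlternatingProduct H H' D b (a * h) := by
  suffices ∀ w, (∃ b, IsAlternatingProduct H H' D b w) →
      ∃ b, IsAlternatingProduct H H' D b (w * h) from this a ⟨true, .base a ha⟩
  induction hh using Subgroup.iSup_induction' with
  | hp c y hy => exact fun w ⟨b, hw⟩ => hw.exists_mul hH hD hy
  | h1 => simp
  | hmul x y _ _ hx hy =>
    intro w hw
    rw [← mul_assoc]
    exact hy _ (hx w hw)

/-- An element of minimal word length in a left coset of `D`. -/
theorem exists_shortest_mul (S : Set G) (D : Subgroup G) (x : G) :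
    ∃ d ∈ D, ∀ e ∈ D, wordLength S (x * d) ≤ wordLength S (x * d * e) := by
  obtain ⟨d, hd⟩ := exists_minimalFor_of_wellFoundedLT (· ∈ D) (fun d => wordLength S (x * d))
    ⟨1, D.one_mem⟩
  refine ⟨d, hd.1, fun e he => ?_⟩
  rw [mul_assoc]
  exact (le_total _ _).elim id (hd.2 (D.mul_mem hd.1 he))

theorem IsAlternatingProduct.add_le_wordLength {S : Set G} {δ K C : ℝ} (hS : IsSymmGenSet S)
    (hδ : 0 ≤ δ) (hhyp : ThinTriangles S δ) (hH : ∀ b, H' b ≤ H b) (hD : ∀ b, D ≤ H' b)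
    (hK : ∀ b, ∀ x ∈ H b, (∀ d ∈ D, wordLength S x ≤ wordLength S (x * d)) →
      ∀ y ∈ H (!b), (wordLength S x : ℝ) + wordLength S y - 2 * K ≤ wordLength S (x * y))
    (hC : 2 * (K + δ + 1) < C) (hlong : ∀ b, ∀ x ∈ H' b, x ∉ D → C ≤ wordLength S x)
    {b : Bool} {w : G} (hw : IsAlternatingProduct H H' D b w) :
    ∃ d ∈ D, (w ∈ H true ∨ C - 2 * (K + δ + 1) ≤ wordLength S (w * d)) ∧
      ∀ y ∈ H (!b), (wordLength S (w * d) : ℝ) + wordLength S y - 2 * (K + δ + 1)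
        ≤ wordLength S (w * d * y) := by
  induction hw with
  | base a ha =>
    obtain ⟨d, hd, hmin⟩ := exists_shortest_mul S D a
    refine ⟨d, hd, .inl ha, fun y hy => ?_⟩
    have := hK true (a * d) ((H true).mul_mem ha (hH _ (hD _ hd))) hmin y hy
    linarith
  | step b u x hu hx hxD ih =>
    obtain ⟨d, hd, -, hud⟩ := ih
    obtain ⟨e, he, hmin⟩ := exists_shortest_mul S D (d⁻¹ * x)
    have hx' : d⁻¹ * x * e ∈ H' (!b) :=
      (H' _).mul_mem ((H' _).mul_mem ((H' _).inv_mem (hD _ hd)) hx) (hD _ he)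
    have hxD' : d⁻¹ * x * e ∉ D := by
      rwa [D.mul_mem_cancel_right he, D.mul_mem_cancel_left (D.inv_mem hd)]
    have hxlen := hlong _ _ hx' hxD'
    have hux := hud _ (hH _ hx')
    have hprod : u * x * e = u * d * (d⁻¹ * x * e) := by group
    refine ⟨e, he, .inr ?_, fun y hy => ?_⟩
    · rw [hprod]
      have : (0 : ℝ) ≤ wordLength S (u * d) := Nat.cast_nonneg _
      linarith
    · rw [hprod]
      exact hhyp.add_le_wordLength_mul hS hux (hK _ _ (hH _ hx') hmin y hy) (by linarith)

end AlternatingProducts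

/-- In a LERF word hyperbolic group `G` (every finitely generated subgroup is
separable), the product `AB` of two quasiconvex subgroups is separable in `G`. -/
theorem product_of_quasiconvex_subgroups_separable_in_LERF
    {G : Type*} [Group G] (S : Set G) (hS : IsSymmGenSet S)
    (δ : ℝ) (hδ : 0 ≤ δ) (hhyp : ThinTriangles S δ)
    (hLERF : ∀ H : Subgroup G, H.FG → SeparableSubset G (H : Set G))
    (A B : Subgroup G)
    (hA : ∃ ε : ℝ, 0 ≤ ε ∧ IsQuasiconvex S ε (A : Set G))
    (hB : ∃ ε : ℝ, 0 ≤ ε ∧ IsQuasiconvex S ε (B : Set G)) :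
    SeparableSubset G ((A : Set G) * (B : Set G)) := by
  obtain ⟨εA, -, hA⟩ := hA
  obtain ⟨εB, -, hB⟩ := hB
  have hAfg := hA.fg hS
  have hBfg := hB.fg hS
  obtain ⟨K₁, hK₁⟩ := exists_bounded_cancellation hS hhyp hA hB
  obtain ⟨K₂, hK₂⟩ := exists_bounded_cancellation hS hhyp hB hA
  set K := max K₁ K₂
  have hDsep : SeparableSubset G ((A ⊓ B : Subgroup G) : Set G) := by
    let := profiniteTopology G
    exact IsClosed.inter (hLERF A hAfg) (hLERF B hBfg)
  let := profiniteTopology G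
  refine isClosed_of_closure_subset fun g hg => ?_
  by_contra hgAB
  obtain ⟨C, hC⟩ := exists_nat_gt (max (2 * (K + δ + 1)) (4 * (K + δ + 1) + wordLength S g))
  obtain ⟨hC₁, hC₂⟩ := max_lt_iff.1 hC
  obtain ⟨M, hM, hDM, hMC⟩ := hDsep.exists_finiteIndex (hS.finite_ball C)
  let H : Bool → Subgroup G := fun b => bif b then A else B
  have hDH : ∀ b, A ⊓ B ≤ H b ⊓ M := by
    rintro (_ | _)
    exacts [le_inf inf_le_right hDM, le_inf inf_le_left hDM]
  have hHfg : (⨆ b, H b ⊓ M).FG := by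
    rw [iSup_bool_eq]
    exact (hAfg.inf_of_finiteIndex M).sup (hBfg.inf_of_finiteIndex M)
  have hclosed : SeparableSubset G
      ((A : Set G) * ((⨆ b, H b ⊓ M : Subgroup G) : Set G) * (B : Set G)) :=
    (hLERF _ hHfg).mul_mul (M := M) (le_iSup (fun b => H b ⊓ M) true)
      (le_iSup (fun b => H b ⊓ M) false)
  have hgmem := closure_minimal (fun x hx => by
    obtain ⟨a, ha, b, hb, rfl⟩ := hx
    exact ⟨a, ⟨a, ha, 1, Subgroup.one_mem _, mul_one a⟩, b, hb, rfl⟩) hclosed hg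
  obtain ⟨_, ⟨a, ha, h, hh, rfl⟩, y, hy, rfl⟩ := hgmem
  have hcancel : ∀ b, ∀ x ∈ H b, (∀ d ∈ A ⊓ B, wordLength S x ≤ wordLength S (x * d)) →
      ∀ y ∈ H (!b), (wordLength S x : ℝ) + wordLength S y - 2 * K ≤ wordLength S (x * y) := by
    rintro (_ | _) x hx hmin z hz
    · have := hK₂ x hx (by rwa [inf_comm]) z hz
      linarith [le_max_right K₁ K₂]
    · have := hK₁ x hx hmin z hz
      linarith [le_max_left K₁ K₂]
  have hlong : ∀ b, ∀ x ∈ H b ⊓ M, x ∉ A ⊓ B → (C : ℝ) ≤ wordLength S x := by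
    intro b x hx hxD
    by_contra hlt
    exact hxD (hMC x (by exact_mod_cast (not_le.1 hlt).le) hx.2)
  have hbound : ∀ u, IsAlternatingProduct H (fun b => H b ⊓ M) (A ⊓ B) true u → ∀ z ∈ B,
      u * z ≠ a * h * y := by
    intro u hu z hz heq
    obtain ⟨d, hd, hud, hadd⟩ := hu.add_le_wordLength hS hδ hhyp (fun b => inf_le_left) hDH
      hcancel hC₁ hlong
    rcases hud with hud | hud
    · exact hgAB ⟨u, hud, z, hz, heq⟩
    · have h1 := hadd (d⁻¹ * z) (B.mul_mem (B.inv_mem hd.2) hz)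
      have h2 : u * d * (d⁻¹ * z) = a * h * y := by rw [← heq]; group
      rw [h2] at h1
      have : (0 : ℝ) ≤ wordLength S (d⁻¹ * z) := Nat.cast_nonneg _
      linarith
  obtain ⟨b, hw⟩ := IsAlternatingProduct.exists_mul_iSup (fun b => inf_le_left) hDH ha hh
  generalize hwdef : a * h = w at hw
  cases b with
  | true => exact hbound _ hw y hy (by rw [hwdef])
  | false =>
    generalize hfalse : false = c at hw
    cases hw with
    | base => cases hfalse
    | step b u x hu hx hxD =>
      obtain rfl : b = true := by simpa using hfalse.symm
      exact hbound u hu (x * y) (B.mul_mem hx.1 hy) (by rw [hwdef, mul_assoc])
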